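/- Let G be a discrete torsionfree subgroup of Isom(E^{1,2}) such that L restricted to G is injective and L(G) is a discrete subgroup of SO₀(1,2), and let Ω be a regular domain with g(Ω) = Ω for all g ∈ G. For φ ∈ G parabolic with Fix(φ) ≠ ∅, let Δ_φ denote the interior, within the line Fix(φ), of Fix(φ) ∩ ∂Ω, where ∂Ω is the topological boundary of Ω in ℝ³. Suppose φ ∈ G is parabolic, ψ ∈ G, p ∈ Δ_φ, ψ(p) ∈ Δ_φ, and ψ(p) ≠ p. Then ψ fixes the line Fix(φ) pointwise. -/

import Mathlib

noncomputable section

/-- Points/vectors of Minkowski space `E^{1,2}`. -/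
abbrev V3 : Type := Fin 3 → ℝ

/-- The Minkowski bilinear form `⟨·,·⟩` of signature `(1,2)`. -/
def mb (v w : V3) : ℝ := -(v 0 * w 0) + v 1 * w 1 + v 2 * w 2

/-- The Minkowski quadratic form. -/
def mq (v : V3) : ℝ := mb v v

def futureTimelike (v : V3) : Prop := mq v < 0 ∧ 0 < v 0
def futureLightlike (v : V3) : Prop := mq v = 0 ∧ 0 < v 0
def futureCausal (v : V3) : Prop := mq v ≤ 0 ∧ 0 < v 0

/-- `SO₀(1,2)`: linear maps preserving the form, of determinant one,
preserving the future causal cone. -/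
def SO12 : Set (Matrix (Fin 3) (Fin 3) ℝ) :=
  {A | (∀ v w, mb (A.mulVec v) (A.mulVec w) = mb v w) ∧ A.det = 1 ∧
       ∀ v, futureCausal v → futureCausal (A.mulVec v)}

/-- A parabolic element of `SO₀(1,2)`. -/
def IsParabolic (A : Matrix (Fin 3) (Fin 3) ℝ) : Prop := A ≠ 1 ∧ (A - 1) ^ 3 = 0

/-- An (affine) isometry of `E^{1,2}` given by its linear part and translation part. -/
abbrev IsomE : Type := Matrix (Fin 3) (Fin 3) ℝ × V3

/-- The action of an isometry on `ℝ³`: `φ(x) = φ_L x + τ_φ`. -/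
def isomApp (g : IsomE) (x : V3) : V3 := g.1.mulVec x + g.2

/-- Composition of isometries. -/
def isomMul (g h : IsomE) : IsomE := (g.1 * h.1, g.1.mulVec h.2 + g.2)

/-- Iterated composition. -/
def isomPow (g : IsomE) : ℕ → IsomE
  | 0 => (1, 0)
  | n + 1 => isomMul g (isomPow g n)

/-- `G` is a subgroup of `Isom(E^{1,2})`. -/
def IsIsomSubgroup (G : Set IsomE) : Prop :=
  (∀ g ∈ G, g.1 ∈ SO12) ∧ ((1 : Matrix (Fin 3) (Fin 3) ℝ), (0 : V3)) ∈ G ∧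
  (∀ g ∈ G, ∀ h ∈ G, isomMul g h ∈ G) ∧
  (∀ g ∈ G, ∃ h ∈ G, isomMul g h = (1, 0) ∧ isomMul h g = (1, 0))

/-- `G` is torsionfree: its only element of finite order is the identity. -/
def IsomTorsionfree (G : Set IsomE) : Prop :=
  ∀ g ∈ G, ∀ n : ℕ, 0 < n → isomPow g n = (1, 0) → g = (1, 0)

/-- The chronological future of the lightlike plane `{x | ⟨x,u⟩ = c}`. -/
def futurePlane (u : V3) (c : ℝ) : Set V3 := {x | mb x u < c}

/-- A regular domain: a nonempty intersection of futures of lightlike planes. -/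
def IsRegularDomain (Ω : Set V3) : Prop :=
  Ω.Nonempty ∧ ∃ Λ : Set (V3 × ℝ), Λ.Nonempty ∧ (∀ p ∈ Λ, futureLightlike p.1) ∧
    Ω = ⋂ p ∈ Λ, futurePlane p.1 p.2

/-- The lightlike line `a + ℝ u`. -/
def linePts (a u : V3) : Set V3 := {x | ∃ s : ℝ, x = a + s • u}

/-- Fixed-point set of an isometry. -/
def FixSet (g : IsomE) : Set V3 := {x | isomApp g x = x}


/-! ### Elementary Lorentzian geometry -/

lemma mb_comm (v w : V3) : mb v w = mb w v := by
  simp only [mb]; ring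

lemma mb_add_left (v w z : V3) : mb (v + w) z = mb v z + mb w z := by
  simp only [mb, Pi.add_apply]; ring

lemma mb_add_right (v w z : V3) : mb v (w + z) = mb v w + mb v z := by
  simp only [mb, Pi.add_apply]; ring

lemma mb_smul_left (r : ℝ) (v w : V3) : mb (r • v) w = r * mb v w := by
  simp only [mb, Pi.smul_apply, smul_eq_mul]; ring

lemma mb_smul_right (r : ℝ) (v w : V3) : mb v (r • w) = r * mb v w := by
  simp only [mb, Pi.smul_apply, smul_eq_mul]; ring

lemma continuous_mb_left (u : V3) : Continuous fun x : V3 => mb x u := by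
  unfold mb; fun_prop

lemma time_ne_zero_of_mq_eq_zero {u : V3} (h : mq u = 0) (hu : u ≠ 0) : u 0 ≠ 0 := by
  intro h0
  apply hu
  simp only [mq, mb, h0] at h
  have h1 : u 1 = 0 := by nlinarith [sq_nonneg (u 1), sq_nonneg (u 2)]
  have h2 : u 2 = 0 := by nlinarith [sq_nonneg (u 1), sq_nonneg (u 2)]
  ext i
  fin_cases i <;> simp [h0, h1, h2]

/-- Spatial Cauchy–Schwarz inequality. -/
lemma spatial_inner_le {a b c d s t : ℝ} (hs : 0 ≤ s) (ht : 0 ≤ t) (h₁ : a ^ 2 + b ^ 2 ≤ s ^ 2)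
    (h₂ : c ^ 2 + d ^ 2 ≤ t ^ 2) : a * c + b * d ≤ s * t := by
  refine le_of_abs_le (abs_le_of_sq_le_sq ?_ (mul_nonneg hs ht))
  nlinarith [sq_nonneg (a * d - b * c), mul_le_mul h₁ h₂ (by positivity) (by positivity)]

lemma mb_nonpos_of_futureCausal {v w : V3} (hv : futureCausal v) (hw : futureCausal w) :
    mb v w ≤ 0 := by
  obtain ⟨hv, hv0⟩ := hv
  obtain ⟨hw, hw0⟩ := hw
  simp only [mq, mb] at hv hw ⊢
  have := spatial_inner_le (a := v 1) (b := v 2) (c := w 1) (d := w 2) hv0.le hw0.le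
    (by nlinarith) (by nlinarith)
  linarith

lemma mb_neg_of_futureTimelike {v n : V3} (hv : futureTimelike v) (hn : futureLightlike n) :
    mb v n < 0 := by
  obtain ⟨hv, hv0⟩ := hv
  obtain ⟨hn, hn0⟩ := hn
  simp only [mq, mb] at hv hn ⊢
  have hlt : (v 1 * n 1 + v 2 * n 2) ^ 2 < (v 0 * n 0) ^ 2 := by
    have h1 : v 1 ^ 2 + v 2 ^ 2 < v 0 ^ 2 := by nlinarith
    have h2 : n 1 ^ 2 + n 2 ^ 2 = n 0 ^ 2 := by nlinarith
    have h3 := mul_lt_mul_of_pos_right h1 (pow_pos hn0 2)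
    nlinarith [sq_nonneg (v 1 * n 2 - v 2 * n 1)]
  have := lt_of_pow_lt_pow_left₀ 2 (mul_pos hv0 hn0).le hlt
  linarith

/-- The orthogonal of the span of a lightlike vector `u` and a non-isotropic vector `w`
orthogonal to it is `ℝ u`. -/
lemma eq_smul_of_orthogonal {u w z : V3} (hu : mq u = 0) (hu0 : u 0 ≠ 0) (hwu : mb w u = 0)
    (hw : mq w ≠ 0) (hzu : mb z u = 0) (hzw : mb z w = 0) : z = (z 0 / u 0) • u := by
  have key : ∀ x y : V3, mb x u = 0 → mb y u = 0 →
      u 0 ^ 2 * mb x y = (u 1 * x 2 - u 2 * x 1) * (u 1 * y 2 - u 2 * y 1) := by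
    intro x y hx hy
    simp only [mq, mb] at hu hx hy ⊢
    linear_combination (-(x 1 * y 1) - x 2 * y 2) * hu - hx * (- (y 0 * u 0)) +
      hy * (u 1 * x 1 + u 2 * x 2)
  have h1 := key w w hwu hwu
  have h2 := key z w hzu hwu
  rw [hzw, mul_zero] at h2
  have hwe : u 1 * w 2 - u 2 * w 1 ≠ 0 := by
    intro h
    rw [h, mul_zero] at h1
    exact hw ((mul_eq_zero.1 h1).resolve_left (pow_ne_zero 2 hu0))
  have hz := (mul_eq_zero.1 h2.symm).resolve_right hwe
  simp only [mq, mb] at hu hzu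
  have hu2 : u 0 ^ 2 ≠ 0 := pow_ne_zero 2 hu0
  have e1 : z 1 = z 0 / u 0 * u 1 := by
    field_simp
    apply mul_left_cancel₀ hu0
    linear_combination (-z 1) * hu + u 1 * hzu - u 2 * hz
  have e2 : z 2 = z 0 / u 0 * u 2 := by
    field_simp
    apply mul_left_cancel₀ hu0
    linear_combination (-z 2) * hu + u 2 * hzu + u 1 * hz
  ext i
  fin_cases i
  · simp [hu0]
  · simpa using e1
  · simpa using e2

/-- A nonzero fixed vector of a parabolic isometry is lightlike. -/
lemma IsParabolic.mq_eq_zero {A : Matrix (Fin 3) (Fin 3) ℝ} (hA : IsParabolic A)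
    (hform : ∀ v w, mb (A.mulVec v) (A.mulVec w) = mb v w) {w : V3} (hw : A.mulVec w = w) :
    mq w = 0 := by
  by_contra hq
  obtain ⟨hne, hcube⟩ := hA
  have hN : ∀ x, (A - 1).mulVec x = A.mulVec x - x := fun x => by
    rw [Matrix.sub_mulVec, Matrix.one_mulVec]
  have horth : ∀ z, A.mulVec z = z → ∀ x, mb ((A - 1).mulVec x) z = 0 := by
    intro z hz x
    have h := hform x z
    have h' : A.mulVec x = (A - 1).mulVec x + x := by rw [hN]; abel
    rw [hz, h', mb_add_left] at h
    linarith
  obtain ⟨x, u, hxu, hu, hNu⟩ : ∃ x u, (A - 1).mulVec x = u ∧ u ≠ 0 ∧ (A - 1).mulVec u = 0 := by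
    obtain ⟨x, hx⟩ : ∃ x, (A - 1).mulVec x ≠ 0 := by
      by_contra! h
      exact hne (sub_eq_zero.1 (Matrix.ext_of_mulVec_single fun i => by rw [h, Matrix.zero_mulVec]))
    by_cases h2 : (A - 1).mulVec ((A - 1).mulVec x) = 0
    · exact ⟨x, _, rfl, hx, h2⟩
    · refine ⟨_, _, rfl, h2, ?_⟩
      rw [Matrix.mulVec_mulVec, Matrix.mulVec_mulVec, ← pow_three', hcube, Matrix.zero_mulVec]
  have hAu : A.mulVec u = u := sub_eq_zero.1 (by rw [← hN, hNu])
  have huu : mq u = 0 := by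
    have := horth u hAu x
    rwa [hxu] at this
  have huw : mb w u = 0 := by
    have := horth w hw x
    rwa [hxu, mb_comm] at this
  have hu0 := time_ne_zero_of_mq_eq_zero huu hu
  have hrange : ∀ y, ∃ f : ℝ, A.mulVec y = y + f • u := by
    intro y
    have := eq_smul_of_orthogonal huu hu0 huw hq (horth u hAu y) (horth w hw y)
    rw [hN] at this
    exact ⟨_, sub_eq_iff_eq_add'.1 this⟩
  have hskew : ∀ (y : V3) (f : ℝ), A.mulVec y = y + f • u → f * mb u y = 0 := by
    intro y f hf
    have h := hform y y
    rw [hf] at h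
    simp only [mb_add_left, mb_add_right, mb_smul_left, mb_smul_right, mb_comm y u] at h
    rw [show mb u u = 0 from huu] at h
    linarith
  have hAx : A.mulVec x = x + (1 : ℝ) • u := by
    rw [one_smul, ← hxu, hN]; abel
  have hx := hskew x 1 hAx
  have hy0 : mb u (Pi.single 0 1) ≠ 0 := by simpa [mb] using hu0
  obtain ⟨f, hf⟩ := hrange (Pi.single 0 1)
  have hf0 := (mul_eq_zero.1 (hskew _ f hf)).resolve_right hy0
  have hsum := hskew (Pi.single 0 1 + x) 1 (by
    rw [Matrix.mulVec_add, hf, hAx, hf0, zero_smul]; abel)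
  rw [mb_add_right] at hsum
  apply hy0
  linarith

/-! ### Regular domains -/

lemma isOpen_setOf_futureTimelike_sub (x : V3) : IsOpen {y | futureTimelike (y - x)} := by
  simp only [futureTimelike, mq, mb, Set.ofPred_and, Pi.sub_apply]
  exact (isOpen_lt (by fun_prop) continuous_const).inter
    (isOpen_lt continuous_const (by fun_prop))

lemma IsRegularDomain.mem_interior_of_futureTimelike_sub {Ω : Set V3} (hΩ : IsRegularDomain Ω) {x y : V3}
    (hx : x ∈ closure Ω) (hxy : futureTimelike (y - x)) : y ∈ interior Ω := by
  obtain ⟨-, Λ, -, hΛ, rfl⟩ := hΩ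
  refine mem_interior.2 ⟨{y | futureTimelike (y - x)}, fun z hz => ?_,
    isOpen_setOf_futureTimelike_sub x, hxy⟩
  refine Set.mem_iInter₂.2 fun n hn => ?_
  have hxn : mb x n.1 ≤ n.2 :=
    closure_minimal (t := {x | mb x n.1 ≤ n.2})
      (fun y hy => (show mb y n.1 < n.2 from Set.mem_iInter₂.1 hy n hn).le)
      (isClosed_le (continuous_mb_left _) continuous_const) hx
  have h := mb_neg_of_futureTimelike hz (hΛ n hn)
  have : mb z n.1 = mb x n.1 + mb (z - x) n.1 := by
    rw [← mb_add_left, add_sub_cancel]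
  simp only [futurePlane, Set.mem_ofPred_eq]
  linarith

/-! ### The stabilizer of a lightlike direction -/

/-- The matrix whose columns form a basis adapted to the lightlike vector `(1, a, b)`. -/
def nullFrame (a b : ℝ) : Matrix (Fin 3) (Fin 3) ℝ := !![1, 0, 1; a, -b, -a; b, a, -b]

/-- The inverse of `nullFrame a b` when `a ^ 2 + b ^ 2 = 1`. -/
def nullFrameInv (a b : ℝ) : Matrix (Fin 3) (Fin 3) ℝ :=
  !![1 / 2, a / 2, b / 2; 0, -b, a; 1 / 2, -a / 2, -b / 2]

/-- The stabilizer of a lightlike direction, in an adapted basis. -/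
def borelMatrix (l r : ℝ) : Matrix (Fin 3) (Fin 3) ℝ :=
  !![l, r, r ^ 2 / l; 0, 1, 2 * r / l; 0, 0, l⁻¹]

/-- The one-parameter group of parabolic isometries fixing `(1, a, b)`. -/
def nullRotation (a b s : ℝ) : Matrix (Fin 3) (Fin 3) ℝ :=
  nullFrame a b * borelMatrix 1 s * nullFrameInv a b

lemma nullFrameInv_mul {a b : ℝ} (hab : a ^ 2 + b ^ 2 = 1) : nullFrameInv a b * nullFrame a b = 1 := by
  ext i j
  fin_cases i <;> fin_cases j <;>
    simp [nullFrame, nullFrameInv, Matrix.mul_apply, Fin.sum_univ_three] <;> grind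

lemma nullFrame_mul {a b : ℝ} (hab : a ^ 2 + b ^ 2 = 1) : nullFrame a b * nullFrameInv a b = 1 :=
  mul_eq_one_comm.1 (nullFrameInv_mul hab)

lemma mb_nullFrame {a b : ℝ} (hab : a ^ 2 + b ^ 2 = 1)
    (x y : V3) : mb ((nullFrame a b).mulVec x) ((nullFrame a b).mulVec y) =
    x 1 * y 1 - 2 * (x 0 * y 2 + x 2 * y 0) := by
  simp [mb, nullFrame, Matrix.mulVec, dotProduct, Fin.sum_univ_three]
  linear_combination (x 0 * y 0 - x 0 * y 2 + x 1 * y 1 - x 2 * y 0 + x 2 * y 2) * hab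

lemma eq_borelMatrix {M : Matrix (Fin 3) (Fin 3) ℝ}
    (hM : ∀ x y : V3, M.mulVec x 1 * M.mulVec y 1
      - 2 * (M.mulVec x 0 * M.mulVec y 2 + M.mulVec x 2 * M.mulVec y 0) =
      x 1 * y 1 - 2 * (x 0 * y 2 + x 2 * y 0))
    (hdet : M.det = 1) (h1 : M 1 0 = 0) (h2 : M 2 0 = 0) :
    M = borelMatrix (M 0 0) (M 0 1) := by
  have h02 := hM (Pi.single 0 1) (Pi.single 2 1)
  have h01 := hM (Pi.single 0 1) (Pi.single 1 1)
  have h12 := hM (Pi.single 1 1) (Pi.single 2 1)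
  have h22 := hM (Pi.single 2 1) (Pi.single 2 1)
  simp [h1, h2] at h02 h01 h12 h22
  rw [Matrix.det_fin_three, h1, h2] at hdet
  have h00 : M 0 0 ≠ 0 := left_ne_zero_of_mul_eq_one h02
  have h21 : M 2 1 = 0 := h01.resolve_left h00
  rw [h21] at hdet h12
  have h11 : M 1 1 = 1 := by linear_combination hdet - M 1 1 * h02
  have e22 : M 2 2 = (M 0 0)⁻¹ := eq_inv_of_mul_eq_one_right h02
  have e12 : M 1 2 = 2 * M 0 1 / M 0 0 := by
    rw [h11, e22] at h12
    field_simp at h12 ⊢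
    linarith
  have e02 : M 0 2 = M 0 1 ^ 2 / M 0 0 := by
    rw [e12, e22] at h22
    field_simp at h22 ⊢
    linarith
  ext i j
  fin_cases i <;> fin_cases j <;> simp [borelMatrix, h1, h2, h11, h21, e22, e12, e02]

lemma borelMatrix_mul_borelMatrix {l : ℝ} (hl : l ≠ 0) (r s : ℝ) :
    borelMatrix l r * borelMatrix 1 s = borelMatrix 1 (l * s) * borelMatrix l r := by
  ext i j
  fin_cases i <;> fin_cases j <;>
    simp [borelMatrix, Matrix.mul_apply, Fin.sum_univ_three] <;> field_simp <;> ring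

lemma borelMatrix_one_add (s t : ℝ) :
    borelMatrix 1 (s + t) = borelMatrix 1 s * borelMatrix 1 t := by
  ext i j
  fin_cases i <;> fin_cases j <;>
    simp [borelMatrix, Matrix.mul_apply, Fin.sum_univ_three] <;> ring

lemma borelMatrix_one_zero : borelMatrix 1 0 = 1 := by
  ext i j
  fin_cases i <;> fin_cases j <;> simp [borelMatrix]

lemma continuous_nullRotation (a b : ℝ) : Continuous (nullRotation a b) := by
  refine (continuous_const.matrix_mul (continuous_matrix fun i j => ?_)).matrix_mul
    continuous_const
  fin_cases i <;> fin_cases j <;> simp [borelMatrix] <;> fun_prop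

lemma nullRotation_zero {a b : ℝ} (hab : a ^ 2 + b ^ 2 = 1) : nullRotation a b 0 = 1 := by
  rw [nullRotation, borelMatrix_one_zero, mul_one, nullFrame_mul hab]

lemma nullRotation_add {a b : ℝ} (hab : a ^ 2 + b ^ 2 = 1)
    (s t : ℝ) :
    nullRotation a b (s + t) = nullRotation a b s * nullRotation a b t := by
  simp only [nullRotation, borelMatrix_one_add]
  calc _ = nullFrame a b * borelMatrix 1 s * 1 * borelMatrix 1 t * nullFrameInv a b := by
        noncomm_ring
    _ = _ := by rw [← nullFrameInv_mul hab]; noncomm_ring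

lemma eq_zero_of_nullRotation_eq_one {a b : ℝ} (hab : a ^ 2 + b ^ 2 = 1)
    {s : ℝ} (h : nullRotation a b s = 1) : s = 0 := by
  have h1 : borelMatrix 1 s = 1 := by
    calc borelMatrix 1 s = (nullFrameInv a b * nullFrame a b) * borelMatrix 1 s *
          (nullFrameInv a b * nullFrame a b) := by rw [nullFrameInv_mul hab]; simp
      _ = nullFrameInv a b * nullRotation a b s * nullFrame a b := by
          simp only [nullRotation, mul_assoc]
      _ = 1 := by rw [h, mul_one, nullFrameInv_mul hab]
  simpa [borelMatrix] using congrFun (congrFun h1 0) 1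

lemma nullRotation_mulVec {a b : ℝ} (hab : a ^ 2 + b ^ 2 = 1)
    (s : ℝ) : (nullRotation a b s).mulVec ![1, a, b] = ![1, a, b] := by
  have h : ![1, a, b] = (nullFrame a b).mulVec ![1, 0, 0] := by
    ext i; fin_cases i <;> simp [nullFrame]
  rw [h, nullRotation, Matrix.mulVec_mulVec, mul_assoc, nullFrameInv_mul hab, mul_one,
    ← Matrix.mulVec_mulVec]
  congr 1
  ext i; fin_cases i <;> simp [borelMatrix]

lemma exists_eq_borelMatrix {a b : ℝ} (hab : a ^ 2 + b ^ 2 = 1)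
    {A : Matrix (Fin 3) (Fin 3) ℝ} (hA : A ∈ SO12) {l : ℝ}
    (hu : A.mulVec ![1, a, b] = l • ![1, a, b]) :
    ∃ r, A = nullFrame a b * borelMatrix l r * nullFrameInv a b := by
  obtain ⟨hform, hdet, -⟩ := hA
  set M := nullFrameInv a b * A * nullFrame a b with hM
  have hSM : nullFrame a b * M = A * nullFrame a b := by
    rw [hM, mul_assoc, ← mul_assoc, nullFrame_mul hab, one_mul]
  have hcol : M.mulVec ![1, 0, 0] = l • ![1, 0, 0] := by
    have h : (nullFrame a b).mulVec ![1, 0, 0] = ![1, a, b] := by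
      ext i; fin_cases i <;> simp [nullFrame]
    rw [hM, mul_assoc, ← Matrix.mulVec_mulVec, ← Matrix.mulVec_mulVec, h, hu, ← h,
      Matrix.mulVec_smul, Matrix.mulVec_mulVec, nullFrameInv_mul hab, Matrix.one_mulVec]
  have hMA : M = borelMatrix (M 0 0) (M 0 1) := by
    apply eq_borelMatrix
    · intro x y
      rw [← mb_nullFrame hab, ← mb_nullFrame hab, Matrix.mulVec_mulVec, Matrix.mulVec_mulVec, hSM,
        ← Matrix.mulVec_mulVec, ← Matrix.mulVec_mulVec, hform]
    · rw [hM, Matrix.det_mul, Matrix.det_mul, hdet, mul_one, ← Matrix.det_mul,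
        nullFrameInv_mul hab, Matrix.det_one]
    · simpa [Matrix.mulVec, dotProduct, Fin.sum_univ_three] using congrFun hcol 1
    · simpa [Matrix.mulVec, dotProduct, Fin.sum_univ_three] using congrFun hcol 2
  have hl : M 0 0 = l := by
    simpa [Matrix.mulVec, dotProduct, Fin.sum_univ_three] using congrFun hcol 0
  refine ⟨M 0 1, ?_⟩
  rw [← hl, ← hMA, hSM, mul_assoc, nullFrame_mul hab, mul_one]

lemma mul_nullRotation {a b : ℝ} (hab : a ^ 2 + b ^ 2 = 1)
    {A : Matrix (Fin 3) (Fin 3) ℝ} (hA : A ∈ SO12) {l : ℝ} (hl : l ≠ 0)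
    (hu : A.mulVec ![1, a, b] = l • ![1, a, b]) (s : ℝ) :
    A * nullRotation a b s = nullRotation a b (l * s) * A := by
  obtain ⟨r, rfl⟩ := exists_eq_borelMatrix hab hA hu
  have h : ∀ X Y : Matrix (Fin 3) (Fin 3) ℝ,
      nullFrame a b * X * nullFrameInv a b * (nullFrame a b * Y * nullFrameInv a b) =
        nullFrame a b * (X * Y) * nullFrameInv a b := by
    intro X Y
    calc _ = nullFrame a b * X * (nullFrameInv a b * nullFrame a b) * Y * nullFrameInv a b := by
          simp only [mul_assoc]
      _ = _ := by rw [nullFrameInv_mul hab]; simp only [mul_assoc, one_mul]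
  rw [nullRotation, nullRotation, h, h, borelMatrix_mul_borelMatrix hl]

/-! ### Discrete groups of isometries -/

lemma isomApp_isomMul (g h : IsomE) (x : V3) :
    isomApp (isomMul g h) x = isomApp g (isomApp h x) := by
  simp only [isomApp, isomMul, Matrix.mulVec_add, Matrix.mulVec_mulVec, add_assoc]

lemma isomApp_add (g : IsomE) (x v : V3) : isomApp g (x + v) = isomApp g x + g.1.mulVec v := by
  simp only [isomApp, Matrix.mulVec_add]; abel

lemma isomApp_one (x : V3) : isomApp (1, 0) x = x := by
  simp [isomApp]

lemma continuous_isomApp (g : IsomE) : Continuous (isomApp g) :=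
  (continuous_const.matrix_mulVec continuous_id).add continuous_const

lemma IsIsomSubgroup.exists_inverse {G : Set IsomE} (hG : IsIsomSubgroup G) {g : IsomE}
    (hg : g ∈ G) {u p : V3} {l c : ℝ} (hl : l ≠ 0) (hu : g.1.mulVec u = l • u)
    (hp : isomApp g p = p + c • u) :
    ∃ h ∈ G, g.1 * h.1 = 1 ∧ h.1 * g.1 = 1 ∧ h.1.mulVec u = l⁻¹ • u ∧
      isomApp h p = p + (-(l⁻¹ * c)) • u := by
  obtain ⟨h, hh, hgh, hhg⟩ := hG.2.2.2 g hg
  have h1 : h.1 * g.1 = 1 := congrArg Prod.fst hhg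
  have hhu : h.1.mulVec u = l⁻¹ • u := by
    have := congrArg h.1.mulVec hu
    rw [Matrix.mulVec_mulVec, h1, Matrix.one_mulVec, Matrix.mulVec_smul] at this
    exact (inv_smul_eq_iff₀ hl).2 this |>.symm
  refine ⟨h, hh, congrArg Prod.fst hgh, h1, hhu, ?_⟩
  have := congrArg (isomApp h) hp
  rw [← isomApp_isomMul, hhg, isomApp_one, isomApp_add, Matrix.mulVec_smul, hhu, smul_smul,
    mul_comm c] at this
  rw [neg_smul, ← sub_eq_add_neg]
  exact eq_sub_of_add_eq this.symm

/-- The pairs `(s, d)` such that some element of `G` with linear part the null rotation of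
parameter `s` moves `p` by `d • (1, a, b)`. -/
def unipotentSubgroup {G : Set IsomE} (hG : IsIsomSubgroup G) {a b : ℝ}
    (hab : a ^ 2 + b ^ 2 = 1) (p : V3) : AddSubgroup (ℝ × ℝ) where
  carrier := {x | ∃ g ∈ G, g.1 = nullRotation a b x.1 ∧ isomApp g p = p + x.2 • ![1, a, b]}
  zero_mem' := ⟨_, hG.2.1, (nullRotation_zero hab).symm, by simp [isomApp_one]⟩
  add_mem' := by
    rintro x y ⟨g, hg, hgx, hgp⟩ ⟨h, hh, hhy, hhp⟩
    refine ⟨isomMul g h, hG.2.2.1 g hg h hh, ?_, ?_⟩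
    · rw [Prod.fst_add, nullRotation_add hab, ← hgx, ← hhy]
      rfl
    · rw [isomApp_isomMul, hhp, isomApp_add, hgp, Matrix.mulVec_smul, hgx,
        nullRotation_mulVec hab, add_assoc, ← add_smul, Prod.snd_add]
  neg_mem' := by
    rintro x ⟨g, hg, hgx, hgp⟩
    obtain ⟨h, hh, -, h1, -, hhp⟩ := hG.exists_inverse hg one_ne_zero
      (by rw [hgx, nullRotation_mulVec hab, one_smul]) hgp
    refine ⟨h, hh, ?_, by simpa using hhp⟩
    rw [hgx] at h1
    calc h.1 = h.1 * (nullRotation a b x.1 * nullRotation a b (-x.1)) := by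
          rw [← nullRotation_add hab, add_neg_cancel, nullRotation_zero hab, mul_one]
      _ = _ := by rw [← mul_assoc, h1, one_mul]; rfl

lemma mem_unipotentSubgroup {G : Set IsomE} (hG : IsIsomSubgroup G) {a b : ℝ}
    (hab : a ^ 2 + b ^ 2 = 1) {p : V3} {x : ℝ × ℝ} : x ∈ unipotentSubgroup hG hab p ↔
      ∃ g ∈ G, g.1 = nullRotation a b x.1 ∧ isomApp g p = p + x.2 • ![1, a, b] :=
  Iff.rfl

lemma exists_fst_mem_unipotentSubgroup_iff {G : Set IsomE} (hG : IsIsomSubgroup G)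
    (hLdisc : DiscreteTopology ↥(Prod.fst '' G)) {a b : ℝ}
    (hab : a ^ 2 + b ^ 2 = 1) (p : V3) :
    ∃ h : ℝ, ∀ s, (∃ d, (s, d) ∈ unipotentSubgroup hG hab p) ↔ ∃ k : ℤ, s = k * h := by
  obtain ⟨U, hU, hUG⟩ := isOpen_induced_iff.1 (isOpen_discrete
    ({⟨1, _, hG.2.1, rfl⟩} : Set ↥(Prod.fst '' G)))
  have h1U : (1 : Matrix (Fin 3) (Fin 3) ℝ) ∈ U := by
    have : (⟨1, _, hG.2.1, rfl⟩ : ↥(Prod.fst '' G)) ∈ Subtype.val ⁻¹' U := by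
      rw [hUG]; rfl
    exact this
  obtain ⟨ε, hε, hball⟩ := Metric.isOpen_iff.1 (hU.preimage (continuous_nullRotation a b)) 0
    (by rwa [Set.mem_preimage, nullRotation_zero hab])
  set H := (unipotentSubgroup hG hab p).map (AddMonoidHom.fst ℝ ℝ) with hH
  have hdisj : Disjoint (H : Set ℝ) (Set.Ioo 0 ε) := by
    rw [Set.disjoint_left]
    rintro _ ⟨x, ⟨g, hg, hgx, -⟩, rfl⟩ ⟨hpos, hlt⟩
    have hmem : nullRotation a b x.1 ∈ U :=
      hball (by simpa [abs_of_pos (show 0 < x.1 from hpos)] using hlt)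
    have : (⟨g.1, g, hg, rfl⟩ : ↥(Prod.fst '' G)) ∈ Subtype.val ⁻¹' U := by
      rw [← hgx] at hmem
      exact hmem
    rw [hUG] at this
    have := eq_zero_of_nullRotation_eq_one hab (hgx.symm.trans (congrArg Subtype.val this))
    exact hpos.ne' this
  obtain ⟨h, hh⟩ := AddSubgroup.cyclic_of_isolated_zero hε hdisj
  refine ⟨h, fun s => ?_⟩
  have : (∃ d, (s, d) ∈ unipotentSubgroup hG hab p) ↔ s ∈ H := by
    simp [hH, AddSubgroup.mem_map]
  rw [this, hh, AddSubgroup.mem_closure_singleton]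
  simp only [zsmul_eq_mul, eq_comm]

/-- In a discrete group containing a null rotation that fixes `p`, no element preserving the
null direction translates `p` along it. -/
lemma displacement_eq_zero {G : Set IsomE} (hG : IsIsomSubgroup G)
    (hLinj : ∀ g ∈ G, ∀ h ∈ G, g.1 = h.1 → g = h)
    (hLdisc : DiscreteTopology ↥(Prod.fst '' G)) {a b : ℝ} (hab : a ^ 2 + b ^ 2 = 1)
    {φ : IsomE} (hφ : φ ∈ G) (hφ1 : φ.1 ≠ 1) (hφu : φ.1.mulVec ![1, a, b] = ![1, a, b])
    {p : V3} (hφp : isomApp φ p = p) {ψ : IsomE} (hψ : ψ ∈ G) {l c : ℝ} (hl : 0 < l)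
    (hψu : ψ.1.mulVec ![1, a, b] = l • ![1, a, b])
    (hψp : isomApp ψ p = p + c • ![1, a, b]) : c = 0 := by
  obtain ⟨s, hs⟩ := exists_eq_borelMatrix hab (hG.1 φ hφ) (l := 1) (by rw [hφu, one_smul])
  have hφK : (s, 0) ∈ unipotentSubgroup hG hab p := ⟨φ, hφ, hs, by simpa using hφp⟩
  have hs0 : s ≠ 0 := by
    rintro rfl
    exact hφ1 (hs.trans (nullRotation_zero hab))
  obtain ⟨h, hH⟩ := exists_fst_mem_unipotentSubgroup_iff hG hLdisc hab p
  have hconj : ∀ g ∈ G, ∀ m d : ℝ, m ≠ 0 → g.1.mulVec ![1, a, b] = m • ![1, a, b] →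
      isomApp g p = p + d • ![1, a, b] → ∀ t, (∃ e, (t, e) ∈ unipotentSubgroup hG hab p) →
      ∃ e, (m * t, e) ∈ unipotentSubgroup hG hab p := by
    rintro g hg m d hm hgu hgp t ⟨e, k, hk, hkt, hkp⟩
    obtain ⟨g', hg', hgg', -, -, hgp'⟩ := hG.exists_inverse hg hm hgu hgp
    refine ⟨d + (e + -(m⁻¹ * d)) * m, isomMul (isomMul g k) g',
      hG.2.2.1 _ (hG.2.2.1 _ hg _ hk) _ hg', ?_, ?_⟩
    · change g.1 * k.1 * g'.1 = nullRotation a b (m * t)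
      rw [hkt, mul_nullRotation hab (hG.1 g hg) hm hgu, mul_assoc, hgg', mul_one]
    · rw [isomApp_isomMul, isomApp_isomMul, hgp', isomApp_add, hkp, hkt, Matrix.mulVec_smul,
        nullRotation_mulVec hab, add_assoc, ← add_smul, isomApp_add, hgp, Matrix.mulVec_smul,
        hgu, smul_smul, add_assoc, ← add_smul]
  obtain ⟨k, hk⟩ := (hH s).1 ⟨0, hφK⟩
  have hk0 : (k : ℝ) ≠ 0 := by
    rintro hk0; rw [hk0, zero_mul] at hk; exact hs0 hk
  have hh0 : h ≠ 0 := by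
    rintro rfl; rw [mul_zero] at hk; exact hs0 hk
  have hhK := (hH h).2 ⟨1, by simp⟩
  obtain ⟨ψ', hψ', -, -, hψu', hψp'⟩ := hG.exists_inverse hψ hl.ne' hψu hψp
  obtain ⟨m, hm⟩ := (hH _).1 (hconj ψ hψ l c hl.ne' hψu hψp h hhK)
  obtain ⟨n, hn⟩ := (hH _).1 (hconj ψ' hψ' _ _ (inv_ne_zero hl.ne') hψu' hψp' h hhK)
  have hm := mul_right_cancel₀ hh0 hm
  have hn := mul_right_cancel₀ hh0 hn
  have hmn : m * n = 1 := by
    have : (m : ℝ) * n = 1 := by rw [← hm, ← hn, mul_inv_cancel₀ hl.ne']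
    exact_mod_cast this
  have hl1 : l = 1 := by
    rcases Int.eq_one_or_neg_one_of_mul_eq_one hmn with rfl | rfl
    · simpa using hm
    · norm_num at hm; linarith
  subst hl1
  obtain ⟨t, ht⟩ := exists_eq_borelMatrix hab (hG.1 ψ hψ) hψu
  have hψK : (t, c) ∈ unipotentSubgroup hG hab p := ⟨ψ, hψ, ht, hψp⟩
  obtain ⟨j, hj⟩ := (hH t).1 ⟨c, hψK⟩
  have hdiff := sub_mem (zsmul_mem hψK k) (zsmul_mem hφK j)
  obtain ⟨g, hg, hg1, hgp⟩ := (mem_unipotentSubgroup hG hab).1 hdiff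
  have h0 : (k • (t, c) - j • (s, (0 : ℝ))).1 = 0 := by
    simp [hj, hk]; ring
  rw [h0, nullRotation_zero hab] at hg1
  rw [hLinj g hg _ hG.2.1 hg1, isomApp_one, left_eq_add] at hgp
  simpa [hk0] using congrFun hgp 0

/-- If `ψ ∈ G` moves a point of the BTZ-line `Δ_φ` (the interior, within the
line `Fix(φ)`, of `Fix(φ) ∩ ∂Ω`) to another point of `Δ_φ`, then `ψ` fixes the
line `Fix(φ)` pointwise. -/
theorem stmt4 (G : Set IsomE) (hG : IsIsomSubgroup G)
    (hGdisc : DiscreteTopology ↥G) (htf : IsomTorsionfree G)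
    (hLinj : ∀ g ∈ G, ∀ h ∈ G, g.1 = h.1 → g = h)
    (hLdisc : DiscreteTopology ↥(Prod.fst '' G))
    (Ω : Set V3) (hΩ : IsRegularDomain Ω) (hinv : ∀ g ∈ G, isomApp g '' Ω = Ω)
    (φ : IsomE) (hφG : φ ∈ G) (hφpar : IsParabolic φ.1)
    (hfix : (FixSet φ).Nonempty)
    (Δφ : Set V3)
    (hΔφ : Δφ = {x ∈ FixSet φ | x ∈ frontier Ω ∧
        ∃ ε > (0 : ℝ), ∀ y ∈ FixSet φ, dist y x < ε → y ∈ FixSet φ ∩ frontier Ω})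
    (ψ : IsomE) (hψ : ψ ∈ G) (p : V3) (hp : p ∈ Δφ)
    (hψp : isomApp ψ p ∈ Δφ) (hne : isomApp ψ p ≠ p) :
    ∀ x ∈ FixSet φ, isomApp ψ x = x := by
  obtain ⟨q, hq, hqp⟩ : ∃ q, q ∈ Δφ ∧ isomApp ψ p = q := ⟨_, hψp, rfl⟩
  rw [hqp] at hne
  rw [hΔφ] at hp hq
  obtain ⟨hpfix, -, ε, hε, hpε⟩ := hp
  obtain ⟨hqfix, -, δ, hδ, hqδ⟩ := hq
  have hpfix' : isomApp φ p = p := hpfix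
  have hφw : φ.1.mulVec (q - p) = q - p := by
    have h : isomApp φ q = q := hqfix
    have h' := isomApp_add φ p (q - p)
    rw [add_sub_cancel, h, hpfix'] at h'
    exact (sub_eq_of_eq_add' h').symm
  have hw : mq (q - p) = 0 := hφpar.mq_eq_zero (hG.1 φ hφG).1 hφw
  have hc := time_ne_zero_of_mq_eq_zero hw (sub_ne_zero.2 hne)
  obtain ⟨c, a, b, hc0, hab, hcu⟩ : ∃ c a b : ℝ, c ≠ 0 ∧ a ^ 2 + b ^ 2 = 1 ∧
      q - p = c • ![1, a, b] := by
    refine ⟨(q - p) 0, (q - p) 1 / (q - p) 0, (q - p) 2 / (q - p) 0, hc, ?_, ?_⟩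
    · simp only [mq, mb] at hw
      field_simp
      linear_combination hw
    · ext i
      fin_cases i
      · simp
      · simp only [Pi.smul_apply, smul_eq_mul]
        exact (mul_div_cancel₀ _ hc).symm
      · simp only [Pi.smul_apply, smul_eq_mul]
        exact (mul_div_cancel₀ _ hc).symm
  have hφu : φ.1.mulVec ![1, a, b] = ![1, a, b] := by
    rw [hcu, Matrix.mulVec_smul] at hφw
    exact smul_right_injective _ hc0 hφw
  have hu : mq ![1, a, b] = 0 := by
    simp [mq, mb]; linarith
  have huc : futureCausal ![1, a, b] := ⟨hu.le, by simp⟩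
  obtain ⟨hform, -, hcausal⟩ := hG.1 ψ hψ
  obtain ⟨v, hv⟩ : ∃ v, ψ.1.mulVec ![1, a, b] = v := ⟨_, rfl⟩
  have hvc : futureCausal v := hv ▸ hcausal _ huc
  have hvv : mq v = 0 := by
    rw [← hv, mq, hform]; exact hu
  rcases (mb_nonpos_of_futureCausal huc hvc).lt_or_eq with hneg | hzero
  · -- transverse null directions: two points of the boundary would be chronologically related
    exfalso
    have hfixline : ∀ x ∈ FixSet φ, ∀ r : ℝ, x + r • ![1, a, b] ∈ FixSet φ := by
      intro x hx r
      change isomApp φ _ = _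
      rw [isomApp_add, Matrix.mulVec_smul, hφu, show isomApp φ x = x from hx]
    have hsmall : ∀ η > (0 : ℝ), ∃ s > (0 : ℝ), ∀ x : V3, ∀ r, |r| ≤ s →
        dist (x + r • ![1, a, b]) x < η := by
      intro η hη
      refine ⟨η / (2 * (‖(![1, a, b] : V3)‖ + 1)), by positivity, fun x r hr => ?_⟩
      rw [dist_self_add_left, norm_smul, Real.norm_eq_abs]
      calc |r| * ‖(![1, a, b] : V3)‖
          ≤ η / (2 * (‖(![1, a, b] : V3)‖ + 1)) * (‖(![1, a, b] : V3)‖ + 1) := by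
            gcongr; linarith
        _ = η / 2 := by field_simp
        _ < η := by linarith
    obtain ⟨s₁, hs₁, h₁⟩ := hsmall ε hε
    obtain ⟨s₂, hs₂, h₂⟩ := hsmall δ hδ
    obtain ⟨s, hs, hle₁, hle₂⟩ : ∃ s > 0, s ≤ s₁ ∧ s ≤ s₂ :=
      ⟨min s₁ s₂, lt_min hs₁ hs₂, min_le_left _ _, min_le_right _ _⟩
    have hpast : p + (-s) • ![1, a, b] ∈ closure Ω :=
      frontier_subset_closure (hpε _ (hfixline p hpfix _)
        (h₁ p _ (by rwa [abs_neg, abs_of_pos hs]))).2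
    have hfuture : q + s • ![1, a, b] ∈ frontier Ω :=
      (hqδ _ (hfixline q hqfix _) (h₂ q _ (by rwa [abs_of_pos hs]))).2
    have himage : q + (-s) • v ∈ closure Ω := by
      have := image_closure_subset_closure_image (continuous_isomApp ψ)
        (Set.mem_image_of_mem _ hpast)
      rwa [hinv ψ hψ, isomApp_add, hqp, Matrix.mulVec_smul, hv] at this
    refine hfuture.2 (hΩ.mem_interior_of_futureTimelike_sub himage ?_)
    have hdiff : q + s • ![1, a, b] - (q + (-s) • v) = s • (![1, a, b] + v) := by
      rw [smul_add, neg_smul]; abel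
    rw [hdiff]
    constructor
    · simp only [mq, mb_smul_left, mb_smul_right, mb_add_left, mb_add_right,
        mb_comm v ![1, a, b]] at hu hvv ⊢
      rw [hu, hvv]
      nlinarith [mul_pos hs hs]
    · have := hvc.2
      simp only [Pi.smul_apply, Pi.add_apply, smul_eq_mul, Matrix.cons_val_zero]
      positivity
  · exfalso
    have hvl : v = v 0 • ![1, a, b] := by
      simp [mq, mb] at hzero hvv
      have hsq : (v 1 - v 0 * a) ^ 2 + (v 2 - v 0 * b) ^ 2 = 0 := by
        linear_combination hvv + v 0 ^ 2 * hab - 2 * v 0 * hzero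
      have e1 : v 1 = v 0 * a := by nlinarith [sq_nonneg (v 1 - v 0 * a), sq_nonneg (v 2 - v 0 * b)]
      have e2 : v 2 = v 0 * b := by nlinarith [sq_nonneg (v 1 - v 0 * a), sq_nonneg (v 2 - v 0 * b)]
      ext i
      fin_cases i
      · simp
      · simpa using e1
      · simpa using e2
    exact hc0 (displacement_eq_zero hG hLinj hLdisc hab hφG hφpar.1 hφu hpfix' hψ hvc.2
      (hv.trans hvl) (by rw [hqp, ← hcu, add_sub_cancel]))
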